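/- arXiv:1708.04397 — 8 statements merged into one kernel-verified Lean document; each statement's English description precedes it below -/
import Mathlib

section
/- The embedding φ of H into G is subnormal: there exist k ∈ ℕ and subgroups G_0 ≤ G_1 ≤ … ≤ G_k of (H Wr ℤ) Wr ℤ with G_0 equal to the image of φ, G_k = G, and G_j normal in G_{j+1} for every 0 ≤ j < k. -/
open SemidirectProduct

section WreathDef

variable (A B : Type*) [Group A] [Group B]

/-- The action of `B` on the base group `B → A` by `(b • f) x = f (x * b)`. -/
def wrAut : B →* MulAut (B → A) where
  toFun b :=
    { toFun := fun f x => f (x * b)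
      invFun := fun f x => f (x * b⁻¹)
      left_inv := fun f => funext fun x => by simp
      right_inv := fun f => funext fun x => by simp
      map_mul' := fun f g => rfl }
  map_one' := by
    ext f x
    simp
  map_mul' := fun b₁ b₂ => by
    ext f x
    simp [mul_assoc]

/-- The (unrestricted) wreath product `A Wr B`, as the semidirect product `(B → A) ⋊ B`. -/
abbrev Wr := (B → A) ⋊[wrAut A B] B

end WreathDef

/-- The infinite cyclic group `ℤ`, written multiplicatively. -/
abbrev Zm := Multiplicative ℤ

section Elements

variable {H : Type*} [Group H]

/-- The element `z` of `H Wr ℤ`: trivial passive part, active part `1 ∈ ℤ`. -/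
def zElt : Wr H Zm := inr (Multiplicative.ofAdd 1)

/-- The element `b i` of `H Wr ℤ`: passive part `k ↦ a i` for `k > 0` and `1` otherwise. -/
def bElt (a : ℕ → H) (i : ℕ) : Wr H Zm :=
  inl fun k => if 0 < Multiplicative.toAdd k then a i else 1

/-- The element `s` of `(H Wr ℤ) Wr ℤ`: trivial passive part, active part `1 ∈ ℤ`. -/
def sElt : Wr (Wr H Zm) Zm := inr (Multiplicative.ofAdd 1)

open Classical in
/-- The element `c` of `(H Wr ℤ) Wr ℤ`: base element with passive part sending
`1 ↦ z`, `2^i ↦ b i` for `i ≥ 1`, and everything else to `1`. -/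
noncomputable def cElt (a : ℕ → H) : Wr (Wr H Zm) Zm :=
  inl fun k =>
    if Multiplicative.toAdd k = 1 then zElt
    else if h : ∃ i : ℕ, 1 ≤ i ∧ Multiplicative.toAdd k = 2 ^ i then bElt a h.choose
    else 1

/-- The subgroup `G = ⟨c, s⟩` of `(H Wr ℤ) Wr ℤ`. -/
noncomputable def Gsub (a : ℕ → H) : Subgroup (Wr (Wr H Zm) Zm) :=
  Subgroup.closure {cElt a, sElt}

/-- The map `φ : H → (H Wr ℤ) Wr ℤ`, sending `h` to the base element supported at `1 ∈ ℤ`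
whose value is the base element of `H Wr ℤ` supported at `0 ∈ ℤ` with value `h`. -/
def phiElt (h : H) : Wr (Wr H Zm) Zm :=
  inl fun k =>
    if Multiplicative.toAdd k = 1 then
      (inl fun m => if Multiplicative.toAdd m = 0 then h else 1 : Wr H Zm)
    else 1

end Elements

section Subnormality

open scoped commutatorElement

variable {H : Type*} [Group H]

lemma wrAut_apply {A B : Type*} [Group A] [Group B] (b : B) (f : B → A) (x : B) :
    wrAut A B b f x = f (x * b) := rfl

/-- `phiElt` as a group homomorphism. -/
def phiHom : H →* Wr (Wr H Zm) Zm where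
  toFun := phiElt
  map_one' := by
    ext : 1
    · funext k
      simp only [phiElt, left_inl, one_left, Pi.one_apply]
      split_ifs
      · ext m <;> simp
      · rfl
    · rfl
  map_mul' x y := by
    simp only [phiElt, ← map_mul]
    congr 1
    funext k
    simp only [Pi.mul_apply]
    split_ifs
    · rw [← map_mul]
      congr 1
      funext m
      simp only [Pi.mul_apply]
      split_ifs <;> simp
    · simp

/-- The homomorphism `(H Wr ℤ) Wr ℤ → ℤ Wr ℤ` induced by the projection `H Wr ℤ → ℤ`. -/
def wrActiveHom : Wr (Wr H Zm) Zm →* Wr Zm Zm :=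
  SemidirectProduct.map (rightHom.compLeft Zm) (MonoidHom.id Zm) fun _ => rfl

lemma mem_ker_wrActiveHom {x : Wr (Wr H Zm) Zm} :
    x ∈ (wrActiveHom (H := H)).ker ↔ (∀ k, (x.left k).right = 1) ∧ x.right = 1 := by
  rw [MonoidHom.mem_ker, SemidirectProduct.ext_iff, funext_iff]
  rfl

lemma phiElt_mem_ker (h : H) : phiElt h ∈ (wrActiveHom (H := H)).ker := by
  refine mem_ker_wrActiveHom.2 ⟨fun k => ?_, rfl⟩
  simp only [phiElt, left_inl]
  split_ifs <;> rfl

lemma conj_phiElt {g : Wr (Wr H Zm) Zm} (hg : g ∈ (wrActiveHom (H := H)).ker) (h : H) :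
    g * phiElt h * g⁻¹ = phiElt
      ((g.left (.ofAdd 1)).left (.ofAdd 0) * h * ((g.left (.ofAdd 1)).left (.ofAdd 0))⁻¹) := by
  obtain ⟨f, n⟩ := g
  obtain ⟨hf, rfl⟩ := mem_ker_wrActiveHom.1 hg
  change ∀ k, (f k).right = 1 at hf
  refine SemidirectProduct.ext (funext fun k => ?_) (by simp [phiElt])
  suffices f k * (phiElt h).left k * (f k)⁻¹ = (phiElt
      ((f (.ofAdd 1)).left (.ofAdd 0) * h * ((f (.ofAdd 1)).left (.ofAdd 0))⁻¹)).left k by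
    simpa [phiElt] using this
  simp only [phiElt, left_inl]
  split_ifs with hk
  · obtain rfl : k = .ofAdd 1 := hk
    refine SemidirectProduct.ext (funext fun m => ?_) (by simp)
    simp only [mul_left, inv_left, mul_right, hf, right_inl, left_inl, inv_one, map_one, one_mul,
      MulAut.one_apply, Pi.mul_apply, Pi.inv_apply]
    split_ifs with hm
    · obtain rfl : m = .ofAdd 0 := hm
      rfl
    · simp
  · simp

lemma cElt_left_one (a : ℕ → H) : (cElt a).left (.ofAdd 1) = zElt := by
  simp [cElt]

lemma cElt_left_two_pow (a : ℕ → H) {i : ℕ} (hi : 1 ≤ i) :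
    (cElt a).left (.ofAdd (2 ^ i)) = bElt a i := by
  have hex : ∃ j : ℕ, 1 ≤ j ∧ (2 : ℤ) ^ i = 2 ^ j := ⟨i, hi, rfl⟩
  have hne : (2 : ℤ) ^ i ≠ 1 := (one_lt_pow₀ (by norm_num) (by omega)).ne'
  simp only [cElt, left_inl, toAdd_ofAdd, if_neg hne, dif_pos hex]
  rw [← pow_right_injective₀ (a := (2 : ℤ)) (by norm_num) (by norm_num) hex.choose_spec.2]

lemma exists_two_pow_of_cElt_left_ne_one (a : ℕ → H) {k : Zm} (hk : (cElt a).left k ≠ 1) :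
    ∃ j : ℕ, k.toAdd = 2 ^ j := by
  simp only [cElt, left_inl] at hk
  split_ifs at hk with h1 h2
  · exact ⟨0, by simpa using h1⟩
  · obtain ⟨j, -, hj⟩ := h2
    exact ⟨j, hj⟩
  · exact absurd rfl hk

lemma commutator_zElt_bElt (a : ℕ → H) (i : ℕ) :
    ⁅(zElt : Wr H Zm), bElt a i⁆ = inl fun m => if m.toAdd = 0 then a i else 1 := by
  refine SemidirectProduct.ext (funext fun m => ?_) (by simp [commutatorElement_def, zElt, bElt])
  simp only [commutatorElement_def, zElt, bElt, ← inl_aut, left_inl,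
    ← map_inv, ← map_mul, Pi.mul_apply, Pi.inv_apply, wrAut_apply, toAdd_mul, toAdd_ofAdd]
  split_ifs <;> first | omega | simp

/-- Two powers of two differing by `2 ^ i - 1` are `1` and `2 ^ i`. -/
lemma two_pow_eq_one_of_add {i m n : ℕ} (hi : 1 ≤ i) (h : (2 : ℤ) ^ n + (2 ^ i - 1) = 2 ^ m) :
    n = 0 := by
  by_contra hn
  obtain ⟨i, rfl⟩ := Nat.exists_eq_add_of_le' hi
  obtain ⟨n, rfl⟩ := Nat.exists_eq_succ_of_ne_zero hn
  have hn' : (0 : ℤ) < 2 ^ n := by positivity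
  have hi' : (0 : ℤ) < 2 ^ i := by positivity
  rcases m with _ | m <;> simp only [Nat.succ_eq_add_one, pow_succ, pow_zero] at h <;> omega

lemma commutator_cElt (a : ℕ → H) {i : ℕ} (hi : 1 ≤ i) :
    ⁅cElt a, inr (.ofAdd (2 ^ i - 1)) * cElt a * (inr (.ofAdd (2 ^ i - 1)))⁻¹⁆ =
      phiElt (a i) := by
  have hc : cElt a = inl (cElt a).left := rfl
  rw [hc, ← map_inv, ← inl_aut, ← map_commutatorElement, phiElt]
  congr 1
  funext k
  change ⁅(cElt a).left k, (cElt a).left (k * .ofAdd (2 ^ i - 1))⁆ = _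
  split_ifs with hk
  · obtain rfl : k = .ofAdd 1 := hk
    rw [← ofAdd_add, add_sub_cancel, cElt_left_one, cElt_left_two_pow a hi, commutator_zElt_bElt]
  · by_cases h1 : (cElt a).left k = 1
    · rw [h1, commutatorElement_one_left]
    by_cases h2 : (cElt a).left (k * .ofAdd (2 ^ i - 1)) = 1
    · rw [h2, commutatorElement_one_right]
    obtain ⟨n, hn⟩ := exists_two_pow_of_cElt_left_ne_one a h1
    obtain ⟨m, hm⟩ := exists_two_pow_of_cElt_left_ne_one a h2
    rw [toAdd_mul, hn, toAdd_ofAdd] at hm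
    rw [two_pow_eq_one_of_add hi hm, pow_zero] at hn
    exact absurd hn hk

lemma inr_ofAdd_mem_Gsub (a : ℕ → H) (n : ℤ) : inr (.ofAdd n) ∈ Gsub a := by
  have h : (inr (.ofAdd n) : Wr (Wr H Zm) Zm) = sElt ^ n := by
    rw [sElt, ← map_zpow, ← ofAdd_zsmul, smul_eq_mul, mul_one]
  rw [h]
  exact zpow_mem (Subgroup.subset_closure (by simp)) n

lemma range_phiHom_le_Gsub (a : ℕ → H)
    (hgen : Subgroup.closure {x : H | ∃ i : ℕ, 1 ≤ i ∧ a i = x} = ⊤) :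
    (phiHom (H := H)).range ≤ Gsub a := by
  rw [MonoidHom.range_eq_map, ← hgen, Subgroup.map_le_iff_le_comap, Subgroup.closure_le]
  rintro _ ⟨i, hi, rfl⟩
  change phiElt (a i) ∈ Gsub a
  have hc : cElt a ∈ Gsub a := Subgroup.subset_closure (by simp)
  have hs := inr_ofAdd_mem_Gsub a (2 ^ i - 1)
  have hd := mul_mem (mul_mem hs hc) (inv_mem hs)
  rw [← commutator_cElt a hi, commutatorElement_def]
  exact mul_mem (mul_mem (mul_mem hc hd) (inv_mem hc)) (inv_mem hd)

end Subnormality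

/-- the embedding φ of `H` into `G` is subnormal. -/
theorem stmt1 {H : Type*} [Group H] (a : ℕ → H)
    (hgen : Subgroup.closure {x : H | ∃ i : ℕ, 1 ≤ i ∧ a i = x} = ⊤) :
    ∃ (k : ℕ) (Gc : ℕ → Subgroup (Wr (Wr H Zm) Zm)),
      (Gc 0 : Set (Wr (Wr H Zm) Zm)) = Set.range (phiElt (H := H)) ∧
      Gc k = Gsub a ∧
      (∀ j : ℕ, j < k → Gc j ≤ Gc (j + 1)) ∧
      (∀ j : ℕ, j < k → ∀ g ∈ Gc (j + 1), ∀ x ∈ Gc j, g * x * g⁻¹ ∈ Gc j) := by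
  refine ⟨2, fun j => match j with
    | 0 => phiHom.range
    | 1 => wrActiveHom.ker ⊓ Gsub a
    | _ => Gsub a, rfl, rfl, fun j hj => ?_, fun j hj => ?_⟩
  · interval_cases j
    · refine le_inf ?_ (range_phiHom_le_Gsub a hgen)
      rintro _ ⟨h, rfl⟩
      exact phiElt_mem_ker h
    · exact inf_le_right
  · interval_cases j
    · rintro g hg _ ⟨h, rfl⟩
      exact ⟨_, (conj_phiElt hg.1 h).symm⟩
    · exact fun g hg x hx =>
        ⟨(wrActiveHom (H := H)).normal_ker.conj_mem x hx.1 g,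
          (Gsub a).mul_mem ((Gsub a).mul_mem hg hx.2) ((Gsub a).inv_mem hg)⟩
end

section
/- If the word problem of H with respect to the generators a_1, a_2, … is solvable — i.e., there exists a computable function d : List (ℕ × Bool) → Bool such that for every list L, d(L) = true if and only if the product in H of the letters a_i^{±1} encoded by L equals 1 — then the word problem of G with respect to the generators c and s is solvable: there exists a computable function e : List (Fin 2 × Bool) → Bool such that for every list L, e(L) = true if and only if the corresponding product of the letters c^{±1}, s^{±1} equals 1 in (H Wr ℤ) Wr ℤ. -/
open SemidirectProduct

/-- The product in `H` of the letters `a i ^ ±1` encoded by a list: the pair `(i, b)`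
encodes the generator `a (i+1)` (inverted when `b = true`). -/
def evalH {H : Type*} [Group H] (a : ℕ → H) (L : List (ℕ × Bool)) : H :=
  (L.map fun p => if p.2 then (a (p.1 + 1))⁻¹ else a (p.1 + 1)).prod

/-- The product in `(H Wr ℤ) Wr ℤ` of the letters `c^±1, s^±1` encoded by a list:
`(0, b)` encodes `c` and `(1, b)` encodes `s` (inverted when `b = true`). -/
noncomputable def evalG {H : Type*} [Group H] (a : ℕ → H) (L : List (Fin 2 × Bool)) :
    Wr (Wr H Zm) Zm :=
  (L.map fun p =>
    if p.2 then (if p.1 = 0 then cElt a else sElt)⁻¹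
    else if p.1 = 0 then cElt a else sElt).prod

theorem Int.encode_eq_ite (x : ℤ) :
    Encodable.encode x = if 0 ≤ x then 2 * x.toNat else 2 * (-x - 1).toNat + 1 := by
  cases x with
  | ofNat n =>
    have h : Encodable.encode (Int.ofNat n) = 2 * n := rfl
    rw [h, if_pos (by simp)]
    simp
  | negSucc n =>
    have h : Encodable.encode (Int.negSucc n) = 2 * n + 1 := rfl
    rw [h, if_neg (by omega)]
    omega

theorem Primrec.int_succ : Primrec fun x : ℤ => x + 1 := by
  have h : Primrec fun e : ℕ => if e % 2 = 0 then e + 2 else e - 2 :=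
    Primrec.ite (Primrec.eq.comp (Primrec.nat_mod.comp .id (.const 2)) (.const 0))
      (Primrec.nat_add.comp .id (.const 2)) (Primrec.nat_sub.comp .id (.const 2))
  refine Primrec.encode_iff.1 ((h.comp Primrec.encode).of_eq fun x => ?_)
  simp only [Int.encode_eq_ite]
  split_ifs <;> omega

theorem Primrec.int_pred : Primrec fun x : ℤ => x - 1 := by
  have h : Primrec fun e : ℕ => if e = 0 then 1 else if e % 2 = 0 then e - 2 else e + 2 :=
    Primrec.ite (Primrec.eq.comp .id (.const 0)) (.const 1) <|
      Primrec.ite (Primrec.eq.comp (Primrec.nat_mod.comp .id (.const 2)) (.const 0))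
        (Primrec.nat_sub.comp .id (.const 2)) (Primrec.nat_add.comp .id (.const 2))
  refine Primrec.encode_iff.1 ((h.comp Primrec.encode).of_eq fun x => ?_)
  simp only [Int.encode_eq_ite]
  rcases lt_trichotomy x 0 with hx | rfl | hx
  · simp only [if_neg hx.not_ge, if_neg (show ¬0 ≤ x - 1 by omega)]
    rw [if_neg (by omega), if_neg (by omega)]
    omega
  · simp
  · simp only [if_pos hx.le, if_pos (show 0 ≤ x - 1 by omega)]
    split_ifs <;> omega

theorem Primrec.int_toNat : Primrec Int.toNat := by
  have h : Primrec fun e : ℕ => if e % 2 = 0 then e / 2 else 0 :=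
    Primrec.ite (Primrec.eq.comp (Primrec.nat_mod.comp .id (.const 2)) (.const 0))
      (Primrec.nat_div.comp .id (.const 2)) (.const 0)
  refine (h.comp Primrec.encode).of_eq fun x => ?_
  simp only [Int.encode_eq_ite]
  split_ifs <;> omega

theorem Primrec.two_pow : Primrec fun n : ℕ => 2 ^ n := by
  have h : Primrec (Nat.rec 1 fun _ y => 2 * y : ℕ → ℕ) :=
    Primrec.nat_rec₁ 1 (Primrec.nat_double.comp Primrec.snd).to₂
  refine h.of_eq fun n => ?_
  induction n with
  | zero => rfl
  | succ n ih => rw [pow_succ', ← ih]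

/-- The exponent `i` if `x = 2 ^ i` is a power of two, and `0` otherwise. -/
def powIdx (x : ℤ) : ℕ :=
  Nat.findGreatest (fun i => 2 ^ i = x.toNat) x.toNat

theorem Primrec.powIdx : Primrec powIdx :=
  Primrec.nat_findGreatest Primrec.int_toNat <|
    Primrec.eq.comp (Primrec.two_pow.comp Primrec.snd) (Primrec.int_toNat.comp Primrec.fst)

theorem powIdx_two_pow (i : ℕ) : powIdx (2 ^ i) = i := by
  have h : ((2 : ℤ) ^ i).toNat = 2 ^ i := by
    have : (2 : ℤ) ^ i = ((2 ^ i : ℕ) : ℤ) := by push_cast; rfl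
    rw [this, Int.toNat_natCast]
  have := Nat.findGreatest_spec (P := fun j => 2 ^ j = 2 ^ i) (Nat.lt_two_pow_self (n := i)).le rfl
  rw [powIdx, h]
  exact Nat.pow_right_injective le_rfl this

theorem eq_two_pow_powIdx {x : ℤ} (hx : powIdx x ≠ 0) : x = 2 ^ powIdx x := by
  have h : 2 ^ powIdx x = x.toNat :=
    Nat.findGreatest_of_ne_zero (P := fun i => 2 ^ i = x.toNat) rfl hx
  have : 0 < x.toNat := h ▸ by positivity
  have h2 : ((2 ^ powIdx x : ℕ) : ℤ) = x := by rw [h]; omega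
  rw [← Nat.cast_ofNat, ← Nat.cast_pow]
  exact h2.symm

/-- Add `-1` or `1` to an integer, according to the sign bit of a letter. -/
def shiftBy (b : Bool) (x : ℤ) : ℤ := if b then x - 1 else x + 1

theorem Primrec.shiftBy : Primrec₂ shiftBy :=
  Primrec.ite (Primrec.eq.comp .fst (.const true)) (Primrec.int_pred.comp .snd)
    (Primrec.int_succ.comp .snd)

/-- One step of the evaluation of a word in `c` and `s` at the outer position `q.1` and the
inner position `q.2.1`; the list `q.2.2` collects the word in the generators of `H`. -/
def scanStep (q : ℤ × ℤ × List (ℕ × Bool)) (p : Fin 2 × Bool) : ℤ × ℤ × List (ℕ × Bool) :=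
  if p.1 = 0 then
    if q.1 = 1 then (q.1, shiftBy p.2 q.2.1, q.2.2)
    else if powIdx q.1 = 0 then q
    else if 0 < q.2.1.toNat then (q.1, q.2.1, q.2.2 ++ [(powIdx q.1 - 1, p.2)])
    else q
  else (shiftBy p.2 q.1, q.2)

theorem Primrec.scanStep : Primrec₂ scanStep := by
  have q1 : Primrec fun r : (ℤ × ℤ × List (ℕ × Bool)) × (Fin 2 × Bool) => r.1.1 :=
    Primrec.fst.comp .fst
  have q2 : Primrec fun r : (ℤ × ℤ × List (ℕ × Bool)) × (Fin 2 × Bool) => r.1.2.1 :=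
    Primrec.fst.comp (Primrec.snd.comp .fst)
  have q3 : Primrec fun r : (ℤ × ℤ × List (ℕ × Bool)) × (Fin 2 × Bool) => r.1.2.2 :=
    Primrec.snd.comp (Primrec.snd.comp .fst)
  have p1 : Primrec fun r : (ℤ × ℤ × List (ℕ × Bool)) × (Fin 2 × Bool) => r.2.1 :=
    Primrec.fst.comp .snd
  have p2 : Primrec fun r : (ℤ × ℤ × List (ℕ × Bool)) × (Fin 2 × Bool) => r.2.2 :=
    Primrec.snd.comp .snd
  refine Primrec.ite (Primrec.eq.comp p1 (.const 0)) ?_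
    (Primrec.pair (Primrec.shiftBy.comp p2 q1) (Primrec.snd.comp .fst))
  refine Primrec.ite (Primrec.eq.comp q1 (.const 1))
    (Primrec.pair q1 (Primrec.pair (Primrec.shiftBy.comp p2 q2) q3)) ?_
  refine Primrec.ite (Primrec.eq.comp (Primrec.powIdx.comp q1) (.const 0)) .fst ?_
  refine Primrec.ite (Primrec.nat_lt.comp (.const 0) (Primrec.int_toNat.comp q2)) ?_ .fst
  exact Primrec.pair q1 (Primrec.pair q2 (Primrec.list_concat.comp q3
    (Primrec.pair (Primrec.nat_sub.comp (Primrec.powIdx.comp q1) (.const 1)) p2)))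

/-- The final state of the evaluation of the word `L` started at the positions `k` and `m`. -/
def scan (L : List (Fin 2 × Bool)) (k m : ℤ) : ℤ × ℤ × List (ℕ × Bool) :=
  L.foldl scanStep (k, m, [])

theorem scan_concat (L : List (Fin 2 × Bool)) (p : Fin 2 × Bool) (k m : ℤ) :
    scan (L ++ [p]) k m = scanStep (scan L k m) p := by
  simp [scan]

theorem Primrec.scan :
    Primrec fun r : List (Fin 2 × Bool) × ℤ × ℤ => scan r.1 r.2.1 r.2.2 :=
  Primrec.list_foldl .fst
    (Primrec.pair (Primrec.fst.comp .snd) (Primrec.pair (Primrec.snd.comp .snd) (.const [])))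
    (Primrec.scanStep.comp (Primrec.fst.comp .snd) (Primrec.snd.comp .snd)).to₂

/-- The bounded conjunction of a computable predicate is computable. -/
theorem Computable.exists_forall_lt {α : Type*} [Primcodable α] {f : α → ℕ → Bool}
    (hf : Computable₂ f) {B : α → ℕ} (hB : Computable B) :
    ∃ e : α → Bool, Computable e ∧ ∀ x, e x = true ↔ ∀ j < B x, f x j = true := by
  refine ⟨_, Computable.nat_rec (h := fun x r => f x r.1 && r.2) hB (Computable.const true)
    ((Primrec.and.to_comp.comp (hf.comp .fst (Computable.fst.comp .snd))
      (Computable.snd.comp .snd))).to₂, fun x => ?_⟩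
  induction B x with
  | zero => simp
  | succ n ih =>
    rw [Nat.forall_lt_succ_right, ← ih, and_comm]
    exact Bool.and_eq_true_iff

section WreathSemantics

variable {H : Type*} [Group H] (a : ℕ → H)

/-- The element encoded by a single letter. -/
noncomputable def evalLetter (p : Fin 2 × Bool) : Wr (Wr H Zm) Zm :=
  if p.2 then (if p.1 = 0 then cElt a else sElt)⁻¹
  else if p.1 = 0 then cElt a else sElt

theorem evalG_concat (L : List (Fin 2 × Bool)) (p : Fin 2 × Bool) :
    evalG a (L ++ [p]) = evalG a L * evalLetter a p := by
  simp [evalG, evalLetter]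

theorem evalH_concat (L : List (ℕ × Bool)) (i : ℕ) (b : Bool) :
    evalH a (L ++ [(i, b)]) = evalH a L * if b then (a (i + 1))⁻¹ else a (i + 1) := by
  simp [evalH]

theorem Wr.mul_left_apply {A B : Type*} [Group A] [Group B] (u v : Wr A B) (x : B) :
    (u * v).left x = u.left x * v.left (x * u.right) := rfl

theorem Wr.inv_left_apply_of_right_eq_one {A B : Type*} [Group A] [Group B] {u : Wr A B}
    (hu : u.right = 1) (x : B) : (u⁻¹).left x = (u.left x)⁻¹ := by
  simp [SemidirectProduct.inv_left, hu]

/-- The value at `k` of the passive part of `c`. -/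
noncomputable def cVal (k : ℤ) : Wr H Zm :=
  if k = 1 then zElt else if powIdx k = 0 then 1 else bElt a (powIdx k)

theorem cElt_left (k : Zm) : (cElt a).left k = cVal a (Multiplicative.toAdd k) := by
  simp only [cElt, cVal, SemidirectProduct.left_inl]
  split_ifs with h1 h2 h3 h3
  · rfl
  · obtain ⟨i, hi, h⟩ := h2
    rw [h, powIdx_two_pow] at h3
    omega
  · have h := h2.choose_spec.2
    congr 1
    conv_rhs => rw [h, powIdx_two_pow]
  · rfl
  · exact absurd ⟨_, Nat.one_le_iff_ne_zero.2 h3, eq_two_pow_powIdx h3⟩ h2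

theorem evalLetter_c_right (b : Bool) : (evalLetter a (0, b)).right = 1 := by
  cases b <;> simp [evalLetter, cElt]

/-- The value at `k` of the passive part of `c` or of its inverse. -/
noncomputable def cPow (b : Bool) (k : ℤ) : Wr H Zm :=
  if b then (cVal a k)⁻¹ else cVal a k

theorem evalLetter_c_left (b : Bool) (k : Zm) :
    (evalLetter a (0, b)).left k = cPow a b (Multiplicative.toAdd k) := by
  cases b
  · simp [evalLetter, cElt_left, cPow]
  · simp only [evalLetter, if_true, cPow]
    rw [Wr.inv_left_apply_of_right_eq_one (by simp [cElt]), cElt_left]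

theorem evalLetter_s (b : Bool) :
    evalLetter a (1, b) = inr (Multiplicative.ofAdd (shiftBy b 0)) := by
  cases b <;> simp [evalLetter, sElt, shiftBy, ofAdd_neg]

theorem cPow_right (b : Bool) (k : ℤ) :
    Multiplicative.toAdd (cPow a b k).right = if k = 1 then shiftBy b 0 else 0 := by
  unfold cPow cVal
  cases b <;> split_ifs <;> simp_all [zElt, bElt, shiftBy]

theorem cPow_left (b : Bool) (k : ℤ) (m : Zm) :
    (cPow a b k).left m =
      if k ≠ 1 ∧ powIdx k ≠ 0 ∧ 0 < Multiplicative.toAdd m then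
        if b then (a (powIdx k))⁻¹ else a (powIdx k)
      else 1 := by
  unfold cPow cVal
  cases b <;> by_cases h1 : k = 1 <;> by_cases h2 : powIdx k = 0 <;>
    by_cases h3 : 0 < Multiplicative.toAdd m <;>
    simp [zElt, bElt, h1, h2, h3, ← map_inv]

theorem shiftBy_eq_add (b : Bool) (x : ℤ) : shiftBy b x = x + shiftBy b 0 := by
  cases b <;> simp [shiftBy, sub_eq_add_neg]

theorem evalG_concat_s (L : List (Fin 2 × Bool)) (b : Bool) :
    (evalG a (L ++ [(1, b)])).left = (evalG a L).left ∧
    Multiplicative.toAdd (evalG a (L ++ [(1, b)])).right =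
      shiftBy b (Multiplicative.toAdd (evalG a L).right) := by
  constructor
  · ext1 k
    rw [evalG_concat, Wr.mul_left_apply, evalLetter_s]
    simp
  · rw [evalG_concat, evalLetter_s, shiftBy_eq_add b (Multiplicative.toAdd _)]
    simp

theorem evalG_concat_c (L : List (Fin 2 × Bool)) (b : Bool) :
    (∀ k, (evalG a (L ++ [(0, b)])).left k = (evalG a L).left k *
      cPow a b (Multiplicative.toAdd k + Multiplicative.toAdd (evalG a L).right)) ∧
    (evalG a (L ++ [(0, b)])).right = (evalG a L).right := by
  constructor
  · intro k
    rw [evalG_concat, Wr.mul_left_apply, evalLetter_c_left]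
    simp
  · rw [evalG_concat, SemidirectProduct.mul_right, evalLetter_c_right, mul_one]

theorem scan_spec (L : List (Fin 2 × Bool)) (k m : ℤ) :
    (scan L k m).1 = k + Multiplicative.toAdd (evalG a L).right ∧
    (scan L k m).2.1 =
      m + Multiplicative.toAdd ((evalG a L).left (Multiplicative.ofAdd k)).right ∧
    evalH a (scan L k m).2.2 =
      ((evalG a L).left (Multiplicative.ofAdd k)).left (Multiplicative.ofAdd m) := by
  induction L using List.reverseRecOn with
  | nil => simp [scan, evalG, evalH]
  | append_singleton L p ih =>
    obtain ⟨i, b⟩ := p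
    obtain ⟨h1, h2, h3⟩ := ih
    rw [scan_concat]
    generalize scan L k m = q at *
    obtain ⟨x, y, l⟩ := q
    simp only at h1 h2 h3
    match i with
    | 0 =>
      obtain ⟨e1, e2⟩ := evalG_concat_c a L b
      rw [e1, e2, Wr.mul_left_apply, ← h3, SemidirectProduct.mul_right, toAdd_mul, cPow_right,
        cPow_left, toAdd_mul, toAdd_ofAdd, toAdd_ofAdd, ← h1, ← add_assoc, ← h2]
      unfold scanStep
      by_cases hx : x = 1
      · simp [hx, shiftBy_eq_add b y]
      by_cases hp : powIdx x = 0
      · simp [hx, hp]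
      by_cases hy : 0 < y
      · have hp' : powIdx x - 1 + 1 = powIdx x := by omega
        simp [hx, hp, hy, evalH_concat, hp']
      · simp [hx, hp, hy]
    | 1 =>
      obtain ⟨e1, e2⟩ := evalG_concat_s a L b
      rw [e1, e2]
      refine ⟨?_, h2, h3⟩
      simp only [scanStep, one_ne_zero, if_false]
      rw [shiftBy_eq_add, h1, shiftBy_eq_add b (Multiplicative.toAdd _)]
      ring

theorem abs_shiftBy_le (b : Bool) (x : ℤ) : |shiftBy b x| ≤ |x| + 1 := by
  cases b <;> simp only [shiftBy] <;> grind

theorem abs_evalG_right_le (L : List (Fin 2 × Bool)) :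
    |Multiplicative.toAdd (evalG a L).right| ≤ L.length := by
  induction L using List.reverseRecOn with
  | nil => simp [evalG]
  | append_singleton L p ih =>
    obtain ⟨i, b⟩ := p
    rw [List.length_append, List.length_singleton]
    push_cast
    match i with
    | 0 => rw [(evalG_concat_c a L b).2]; omega
    | 1 =>
      rw [(evalG_concat_s a L b).2]
      exact (abs_shiftBy_le b _).trans (by omega)

theorem evalG_left_stable (L : List (Fin 2 × Bool)) (k : Zm) :
    |Multiplicative.toAdd ((evalG a L).left k).right| ≤ L.length ∧
    (∀ m : Zm, Multiplicative.toAdd m ≤ -L.length → ((evalG a L).left k).left m = 1) ∧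
    ∀ m m' : Zm, (L.length : ℤ) < Multiplicative.toAdd m →
      (L.length : ℤ) < Multiplicative.toAdd m' →
      ((evalG a L).left k).left m = ((evalG a L).left k).left m' := by
  induction L using List.reverseRecOn with
  | nil => simp [evalG]
  | append_singleton L p ih =>
    obtain ⟨i, b⟩ := p
    obtain ⟨h1, h2, h3⟩ := ih
    simp only [List.length_append, List.length_singleton]
    push_cast
    match i with
    | 0 =>
      have hs : |shiftBy b 0| ≤ 1 := by simpa using abs_shiftBy_le b 0
      rw [(evalG_concat_c a L b).1]
      generalize Multiplicative.toAdd k + Multiplicative.toAdd (evalG a L).right = x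
      refine ⟨?_, fun m hm => ?_, fun m m' hm hm' => ?_⟩
      · rw [SemidirectProduct.mul_right, toAdd_mul, cPow_right]
        refine (abs_add_le _ _).trans (add_le_add h1 ?_)
        split_ifs <;> simp [hs]
      · rw [Wr.mul_left_apply, h2 m (by omega), cPow_left, if_neg, one_mul]
        rw [toAdd_mul]
        rw [abs_le] at h1
        omega
      · rw [abs_le] at h1
        rw [Wr.mul_left_apply, Wr.mul_left_apply, h3 m m' (by omega) (by omega), cPow_left,
          cPow_left, toAdd_mul, toAdd_mul]
        congr 2
        rw [eq_iff_iff]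
        constructor <;> rintro ⟨u, v, -⟩ <;> exact ⟨u, v, by omega⟩
    | 1 =>
      rw [(evalG_concat_s a L b).1]
      exact ⟨by omega, fun m hm => h2 m (by omega), fun m m' hm hm' => h3 m m' (by omega) (by omega)⟩

/-- If only the position `t` of a window sees a nontrivial value `g` of the passive part of `c`,
the value of the word there is the power of `g` whose exponent is the active part at `1 - t`. -/
theorem evalG_left_eq_zpow (L : List (Fin 2 × Bool)) (k t : ℤ) (g : Wr H Zm)
    (hg : ∀ u : ℤ, |u| ≤ L.length → cVal a (k + u) = if u = t then g else 1) :
    (evalG a L).left (Multiplicative.ofAdd k) =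
      g ^ Multiplicative.toAdd ((evalG a L).left (Multiplicative.ofAdd (1 - t))).right := by
  induction L using List.reverseRecOn with
  | nil => simp [evalG]
  | append_singleton L p ih =>
    obtain ⟨i, b⟩ := p
    simp only [List.length_append, List.length_singleton] at hg
    push_cast at hg
    have ih := ih fun u hu => hg u (by omega)
    match i with
    | 0 =>
      have hu := hg _ ((abs_evalG_right_le a L).trans (by omega))
      rw [(evalG_concat_c a L b).1, (evalG_concat_c a L b).1, ih, SemidirectProduct.mul_right,
        toAdd_mul, cPow_right, zpow_add, toAdd_ofAdd, toAdd_ofAdd]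
      congr 1
      rw [cPow, hu]
      by_cases ht : Multiplicative.toAdd (evalG a L).right = t
      · cases b <;> simp [ht, shiftBy]
      · have h1 : ¬1 - t + Multiplicative.toAdd (evalG a L).right = 1 := fun h => ht (by linarith)
        simp [ht, h1]
    | 1 => rw [(evalG_concat_s a L b).1, ih]

theorem cVal_eq_one_of_nonpos {k : ℤ} (hk : k ≤ 0) : cVal a k = 1 := by
  have hp : powIdx k = 0 := by
    by_contra h
    have := eq_two_pow_powIdx h
    have : (0 : ℤ) < 2 ^ powIdx k := by positivity
    omega
  rw [cVal, if_neg (by omega), if_pos hp]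

theorem evalG_left_eq_one_of_lt {L : List (Fin 2 × Bool)} {k : ℤ} (hk : k < -L.length) :
    (evalG a L).left (Multiplicative.ofAdd k) = 1 := by
  rw [evalG_left_eq_zpow a L k 0 1, one_zpow]
  intro u hu
  rw [abs_le] at hu
  rw [cVal_eq_one_of_nonpos a (by omega), ite_self]

theorem eq_of_two_pow_sub_lt {x y n : ℤ} (hx : 2 * n < x) (hy : 2 * n < y) (h : |x - y| ≤ 2 * n)
    (hpx : powIdx x ≠ 0) (hpy : powIdx y ≠ 0) : x = y := by
  wlog hxy : powIdx x ≤ powIdx y generalizing x y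
  · exact (this hy hx (by rwa [abs_sub_comm]) hpy hpx (by omega)).symm
  obtain hlt | heq := hxy.lt_or_eq
  · have h2 : (2 : ℤ) ^ (powIdx x + 1) ≤ 2 ^ powIdx y := pow_le_pow_right₀ (by norm_num) hlt
    rw [pow_succ, ← eq_two_pow_powIdx hpx, ← eq_two_pow_powIdx hpy] at h2
    rw [abs_le] at h
    omega
  · rw [eq_two_pow_powIdx hpx, eq_two_pow_powIdx hpy, heq]

theorem evalG_left_eq_one_of_gt {L : List (Fin 2 × Bool)} {k : ℤ} (hk : 3 * L.length + 1 < k)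
    (h : ∀ t : ℤ, |t| ≤ L.length →
      ((evalG a L).left (Multiplicative.ofAdd (1 - t))).right = 1) :
    (evalG a L).left (Multiplicative.ofAdd k) = 1 := by
  by_cases ht : ∃ t : ℤ, |t| ≤ L.length ∧ powIdx (k + t) ≠ 0
  · obtain ⟨t, ht, hp⟩ := ht
    rw [evalG_left_eq_zpow a L k t (cVal a (k + t)), h t ht, toAdd_one, zpow_zero]
    intro u hu
    split_ifs with hut
    · rw [hut]
    · rw [abs_le] at hu ht
      rw [cVal, if_neg (by omega), if_pos]
      by_contra hpu
      have := eq_of_two_pow_sub_lt (n := L.length) (by omega) (by omega)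
        (abs_le.2 (by constructor <;> omega)) hp hpu
      omega
  · push Not at ht
    rw [evalG_left_eq_zpow a L k 0 1, one_zpow]
    intro u hu
    have := ht u hu
    rw [abs_le] at hu
    rw [cVal, if_neg (by omega), if_pos this, ite_self]

/-- Triviality of a word in `c` and `s` is witnessed on a bounded range of positions. -/
theorem evalG_eq_one_iff (L : List (Fin 2 × Bool)) :
    evalG a L = 1 ↔ ∀ k m : ℤ, |k| ≤ 3 * L.length + 1 → |m| ≤ L.length + 1 →
      (scan L k m).1 = k ∧ (scan L k m).2.1 = m ∧ evalH a (scan L k m).2.2 = 1 := by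
  constructor
  · intro h k m _ _
    have := scan_spec a L k m
    simpa [h] using this
  · intro h
    have hr : (evalG a L).right = 1 := by
      have := (scan_spec a L 0 0).1
      rw [(h 0 0 (by simp; omega) (by simp; omega)).1] at this
      rw [← toAdd_eq_zero]
      omega
    have hright (k : ℤ) (hk : |k| ≤ 3 * L.length + 1) :
        ((evalG a L).left (Multiplicative.ofAdd k)).right = 1 := by
      have := (scan_spec a L k 0).2.1
      rw [(h k 0 hk (by simp; omega)).2.1] at this
      rw [← toAdd_eq_zero]
      omega
    have hleft (k m : ℤ) (hk : |k| ≤ 3 * L.length + 1) (hm : |m| ≤ L.length + 1) :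
        ((evalG a L).left (Multiplicative.ofAdd k)).left (Multiplicative.ofAdd m) = 1 := by
      rw [← (scan_spec a L k m).2.2, (h k m hk hm).2.2]
    have key (k : ℤ) : (evalG a L).left (Multiplicative.ofAdd k) = 1 := by
      rcases lt_or_ge k (-L.length) with hk | hk
      · exact evalG_left_eq_one_of_lt a hk
      rcases lt_or_ge (3 * L.length + 1 : ℤ) k with hk' | hk'
      · refine evalG_left_eq_one_of_gt a hk' fun t ht => hright _ ?_
        rw [abs_le] at ht ⊢
        constructor <;> omega
      have hkb : |k| ≤ 3 * L.length + 1 := abs_le.2 (by constructor <;> omega)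
      refine SemidirectProduct.ext (funext fun m => ?_) (hright k hkb)
      obtain ⟨-, hneg, hpos⟩ := evalG_left_stable a L (Multiplicative.ofAdd k)
      rcases le_or_gt (Multiplicative.toAdd m) (-L.length) with hm | hm
      · exact hneg m hm
      rcases lt_or_ge (L.length : ℤ) (Multiplicative.toAdd m) with hm' | hm'
      · rw [hpos m (Multiplicative.ofAdd (L.length + 1)) hm' (by simp)]
        exact hleft k _ hkb (by rw [abs_of_nonneg]; omega)
      · exact hleft k (Multiplicative.toAdd m) hkb (abs_le.2 (by constructor <;> omega))
    exact SemidirectProduct.ext (funext fun k => key (Multiplicative.toAdd k)) hr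

end WreathSemantics

/-- An integer of absolute value at most `n` has code at most `2 * n`. -/
theorem Int.encode_le {x : ℤ} {n : ℕ} (hx : |x| ≤ n) : Encodable.encode x ≤ 2 * n := by
  rw [abs_le] at hx
  rw [Int.encode_eq_ite]
  split_ifs <;> omega

/-- if the word problem of `H` w.r.t. the generators `a_1, a_2, …` is solvable,
then the word problem of `G` w.r.t. the generators `c, s` is solvable. -/
theorem stmt2 {H : Type*} [Group H] (a : ℕ → H)
    (hgen : Subgroup.closure {x : H | ∃ i : ℕ, 1 ≤ i ∧ a i = x} = ⊤)
    (hWP : ∃ d : List (ℕ × Bool) → Bool, Computable d ∧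
      ∀ L : List (ℕ × Bool), d L = true ↔ evalH a L = 1) :
    ∃ e : List (Fin 2 × Bool) → Bool, Computable e ∧
      ∀ L : List (Fin 2 × Bool), e L = true ↔ evalG a L = 1 := by
  obtain ⟨d, hd, hdH⟩ := hWP
  have hpos : Primrec fun j : ℕ =>
      (Denumerable.ofNat ℤ j.unpair.1, Denumerable.ofNat ℤ j.unpair.2) :=
    Primrec.pair ((Primrec.ofNat ℤ).comp (Primrec.fst.comp Primrec.unpair))
      ((Primrec.ofNat ℤ).comp (Primrec.snd.comp Primrec.unpair))
  have hscan : Primrec fun r : List (Fin 2 × Bool) × ℕ => scan r.1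
      (Denumerable.ofNat ℤ r.2.unpair.1) (Denumerable.ofNat ℤ r.2.unpair.2) :=
    Primrec.scan.comp (Primrec.pair .fst (hpos.comp .snd))
  let f (L : List (Fin 2 × Bool)) (j : ℕ) : Bool :=
    let k := Denumerable.ofNat ℤ j.unpair.1
    let m := Denumerable.ofNat ℤ j.unpair.2
    decide ((scan L k m).1 = k) && (decide ((scan L k m).2.1 = m) && d (scan L k m).2.2)
  have hf : Computable₂ f := by
    have h1 := Primrec.eq.decide.comp (Primrec.fst.comp hscan)
      (Primrec.fst.comp (hpos.comp Primrec.snd))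
    have h2 := Primrec.eq.decide.comp (Primrec.fst.comp (Primrec.snd.comp hscan))
      (Primrec.snd.comp (hpos.comp Primrec.snd))
    have h3 := hd.comp (Primrec.snd.comp (Primrec.snd.comp hscan)).to_comp
    exact Primrec.and.to_comp.comp h1.to_comp (Primrec.and.to_comp.comp h2.to_comp h3)
  let B (L : List (Fin 2 × Bool)) : ℕ :=
    (6 * L.length + 3) * (6 * L.length + 3)
  have hB : Computable B := by
    have h : Primrec fun L : List (Fin 2 × Bool) => 6 * L.length + 3 :=
      Primrec.nat_add.comp (Primrec.nat_mul.comp (.const 6) Primrec.list_length) (.const 3)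
    exact (Primrec.nat_mul.comp h h).to_comp
  obtain ⟨e, he, hef⟩ := Computable.exists_forall_lt hf hB
  refine ⟨e, he, fun L => ?_⟩
  rw [hef, evalG_eq_one_iff]
  constructor
  · intro h k m hk hm
    have hk' := Int.encode_le (n := 3 * L.length + 1) (by exact_mod_cast hk)
    have hm' := Int.encode_le (n := L.length + 1) (by exact_mod_cast hm)
    have hj : Nat.pair (Encodable.encode k) (Encodable.encode m) < B L := by
      refine (Nat.pair_lt_max_add_one_sq _ _).trans_le ?_
      rw [sq]
      exact Nat.mul_le_mul (by omega) (by omega)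
    have := h _ hj
    simp only [f, Nat.unpair_pair, Denumerable.ofNat_encode] at this
    simpa [hdH] using this
  · intro h j _
    have hall := (evalG_eq_one_iff a L).2 h
    have := scan_spec a L (Denumerable.ofNat ℤ j.unpair.1) (Denumerable.ofNat ℤ j.unpair.2)
    simpa [f, hdH, hall] using this
end

section
/- If w = (c^{s^{γ₁}})^{β₁}···(c^{s^{γₙ}})^{βₙ}·s^γ equals the identity in (H Wr ℤ) Wr ℤ, then γ = 0 and for every i ∈ {1,…,n} the sum ∑_{j : γⱼ = γᵢ} βⱼ equals 0. -/
open SemidirectProduct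

/-- The base-subgroup element `f = (c^(s^(γ 1)))^(β 1) ⋯ (c^(s^(γ n)))^(β n)`,
where `x ^ y = y * x * y⁻¹`. -/
noncomputable def fProd {H : Type*} [Group H] (a : ℕ → H) {n : ℕ} (β γ : Fin n → ℤ) :
    Wr (Wr H Zm) Zm :=
  ((List.finRange n).map fun j => (sElt ^ γ j * cElt a * (sElt ^ γ j)⁻¹) ^ β j).prod

/-- `γ₀ = max_j |γ j|`. -/
def gamma0 {n : ℕ} (γ : Fin n → ℤ) : ℕ :=
  Finset.univ.sup fun j => (γ j).natAbs

/-- The passive part of `cElt a`. -/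
noncomputable def cFun {H : Type*} [Group H] (a : ℕ → H) : Zm → Wr H Zm := (cElt a).left

theorem inl_cFun {H : Type*} [Group H] (a : ℕ → H) : inl (cFun a) = cElt a := rfl

theorem rightHom_cFun {H : Type*} [Group H] (a : ℕ → H) (k : Zm) :
    rightHom (cFun a k) = Multiplicative.ofAdd (if Multiplicative.toAdd k = 1 then (1 : ℤ) else 0) := by
  unfold cFun cElt
  simp only [left_inl]
  split_ifs <;> simp [zElt, bElt]

theorem sElt_zpow {H : Type*} [Group H] (m : ℤ) :
    (sElt ^ m : Wr (Wr H Zm) Zm) = inr (Multiplicative.ofAdd m) := by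
  rw [sElt, ← map_zpow, ← ofAdd_zsmul, smul_eq_mul, mul_one]

/-- The passive part of `fProd a β γ`. -/
noncomputable def fFun {H : Type*} [Group H] (a : ℕ → H) {n : ℕ} (β γ : Fin n → ℤ) :
    Zm → Wr H Zm :=
  ((List.finRange n).map fun j =>
    (wrAut (Wr H Zm) Zm (Multiplicative.ofAdd (γ j)) (cFun a)) ^ β j).prod

theorem fProd_eq_inl {H : Type*} [Group H] (a : ℕ → H) {n : ℕ} (β γ : Fin n → ℤ) :
    fProd a β γ = inl (fFun a β γ) := by
  rw [fProd, fFun, map_list_prod, List.map_map]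
  congr 2
  funext j
  simp only [Function.comp_apply, map_zpow, inl_aut, sElt_zpow, inl_cFun, map_inv]

theorem toAdd_rightHom_fFun {H : Type*} [Group H] (a : ℕ → H) {n : ℕ} (β γ : Fin n → ℤ)
    (k : ℤ) :
    Multiplicative.toAdd (rightHom (fFun a β γ (Multiplicative.ofAdd k))) =
      ∑ j ∈ Finset.univ.filter fun j => k + γ j = 1, β j := by
  have h : rightHom (fFun a β γ (Multiplicative.ofAdd k)) =
      ((List.finRange n).map fun j =>
        Multiplicative.ofAdd (if k + γ j = 1 then β j else 0)).prod := by
    change (rightHom.comp (Pi.evalMonoidHom (fun _ : Zm => Wr H Zm) (Multiplicative.ofAdd k)))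
      (fFun a β γ) = _
    rw [fFun, map_list_prod, List.map_map]
    congr 2
    funext j
    simp only [Function.comp_apply, map_zpow]
    change (rightHom (cFun a (Multiplicative.ofAdd k * Multiplicative.ofAdd (γ j)))) ^ β j = _
    rw [rightHom_cFun, ← ofAdd_zsmul]
    simp
  rw [h, ← List.ofFn_eq_map, List.prod_ofFn, toAdd_prod, Finset.sum_filter]
  rfl

/-- Lemma 1: if `(c^(s^(γ 1)))^(β 1) ⋯ (c^(s^(γ n)))^(β n) * s^γ = 1`,
then `γ = 0` and `∑_{j : γ j = γ i} β j = 0` for every `i`. -/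
theorem stmt7 {H : Type*} [Group H] (a : ℕ → H)
    (hgen : Subgroup.closure {x : H | ∃ i : ℕ, 1 ≤ i ∧ a i = x} = ⊤)
    (n : ℕ) (hn : 1 ≤ n) (β γ : Fin n → ℤ) (hβ : ∀ j, β j ≠ 0) (g : ℤ)
    (hw : fProd a β γ * sElt ^ g = 1) :
    g = 0 ∧ ∀ i : Fin n, (∑ j ∈ Finset.univ.filter fun j => γ j = γ i, β j) = 0 := by
  rw [fProd_eq_inl, sElt_zpow] at hw
  have hg : g = 0 := by
    have := congrArg rightHom hw
    simpa using this
  refine ⟨hg, fun i => ?_⟩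
  have hf : fFun a β γ = 1 := by
    rw [hg, ofAdd_zero, map_one, mul_one] at hw
    exact inl_injective (hw.trans (map_one inl).symm)
  have := toAdd_rightHom_fFun a β γ (1 - γ i)
  rw [hf, Pi.one_apply, map_one, toAdd_one] at this
  rw [this]
  congr 1
  ext j
  simp only [Finset.mem_filter, Finset.mem_univ, true_and]
  omega
end

section
/- Suppose that for every i ∈ {1,…,n} the sum ∑_{j : γⱼ = γᵢ} βⱼ equals 0, and let γ₀ = max_j |γⱼ|. Then for every integer μ with |μ| > 3γ₀, the passive part of f = (c^{s^{γ₁}})^{β₁}···(c^{s^{γₙ}})^{βₙ}, regarded as a function ℤ → H Wr ℤ, takes the value 1 at μ. -/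
open SemidirectProduct

/-- The passive part of `cElt a`. -/
theorem cElt_eq_inl {H : Type*} [Group H] (a : ℕ → H) :
    cElt a = inl (cElt a).left := by
  simp [cElt]

/-- The passive part of `cElt a` is supported on the powers of two. -/
theorem exists_pow_of_cElt_left_ne_one {H : Type*} [Group H] (a : ℕ → H) {k : ℤ}
    (h : (cElt a).left (Multiplicative.ofAdd k) ≠ 1) : ∃ i : ℕ, k = 2 ^ i := by
  by_contra! hk
  refine h ?_
  have h1 : k ≠ 1 := by simpa using hk 0
  have h2 : ¬ ∃ i : ℕ, 1 ≤ i ∧ k = 2 ^ i := fun ⟨i, _, hi⟩ => hk i hi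
  simp [cElt, h1, h2]

theorem sElt_conj_cElt_zpow {H : Type*} [Group H] (a : ℕ → H) (b g : ℤ) :
    (sElt ^ g * cElt a * (sElt ^ g)⁻¹) ^ b =
      inl fun x => (cElt a).left (x * Multiplicative.ofAdd g) ^ b := by
  have hs : (sElt ^ g : Wr (Wr H Zm) Zm) = inr (Multiplicative.ofAdd g) := by
    rw [sElt, ← map_zpow, ← ofAdd_zsmul, smul_eq_mul, mul_one]
  rw [hs, cElt_eq_inl, ← map_inv, ← inl_aut, ← map_zpow]
  rfl

theorem fProd_left_apply {H : Type*} [Group H] (a : ℕ → H) {n : ℕ} (β γ : Fin n → ℤ) (μ : ℤ) :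
    (fProd a β γ).left (Multiplicative.ofAdd μ) =
      ((List.finRange n).map fun j =>
        (cElt a).left (Multiplicative.ofAdd (μ + γ j)) ^ β j).prod := by
  have h : fProd a β γ = inl (((List.finRange n).map fun j =>
      fun x => (cElt a).left (x * Multiplicative.ofAdd (γ j)) ^ β j).prod) := by
    simp only [fProd, sElt_conj_cElt_zpow, map_list_prod, List.map_map]
    rfl
  rw [h, left_inl, Pi.list_prod_apply, List.map_map]
  rfl

theorem list_prod_map_const_zpow {G ι : Type*} [Group G] (w : G) (e : ι → ℤ) (l : List ι) :
    (l.map fun j => w ^ e j).prod = w ^ (l.map e).sum := by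
  induction l with
  | nil => simp
  | cons j l ih => simp [ih, zpow_add]

/-- Two distinct powers of two are at least as far apart as the smaller one. -/
theorem two_mul_two_pow_le_of_lt {i j : ℕ} (h : (2 : ℤ) ^ i < 2 ^ j) :
    2 * (2 : ℤ) ^ i ≤ 2 ^ j := by
  have hij : i < j := (pow_lt_pow_iff_right₀ (by norm_num)).1 h
  rw [← pow_succ']
  exact pow_le_pow_right₀ (by norm_num) hij

theorem abs_le_gamma0 {n : ℕ} (γ : Fin n → ℤ) (j : Fin n) : |γ j| ≤ (gamma0 γ : ℤ) := by
  rw [Int.abs_eq_natAbs]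
  exact_mod_cast Finset.le_sup (f := fun j => (γ j).natAbs) (Finset.mem_univ j)

/-- Far from the origin, at most one shift by some `γ j` meets the powers of two. -/
theorem eq_of_add_eq_two_pow {r μ x y : ℤ} (hμ : 3 * r < |μ|) (hx : |x| ≤ r) (hy : |y| ≤ r)
    {i j : ℕ} (hi : μ + x = 2 ^ i) (hj : μ + y = 2 ^ j) : x = y := by
  have hi0 : (0 : ℤ) < 2 ^ i := by positivity
  rw [abs_le] at hx hy
  rw [lt_abs] at hμ
  rcases lt_trichotomy ((2 : ℤ) ^ i) (2 ^ j) with h | h | h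
  · have := two_mul_two_pow_le_of_lt h
    omega
  · omega
  · have := two_mul_two_pow_le_of_lt h
    omega

/-- Lemma 2: if `∑_{j : γ j = γ i} β j = 0` for all `i`, then the passive part
of `f = (c^(s^(γ 1)))^(β 1) ⋯ (c^(s^(γ n)))^(β n)` takes the value `1` at every `μ` with
`|μ| > 3 γ₀`. -/
theorem stmt8 {H : Type*} [Group H] (a : ℕ → H)
    (hgen : Subgroup.closure {x : H | ∃ i : ℕ, 1 ≤ i ∧ a i = x} = ⊤)
    (n : ℕ) (hn : 1 ≤ n) (β γ : Fin n → ℤ) (hβ : ∀ j, β j ≠ 0)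
    (hsum : ∀ i : Fin n, (∑ j ∈ Finset.univ.filter fun j => γ j = γ i, β j) = 0) :
    ∀ μ : ℤ, 3 * (gamma0 γ : ℤ) < |μ| →
      (fProd a β γ).left (Multiplicative.ofAdd μ) = 1 := by
  intro μ hμ
  rw [fProd_left_apply]
  by_cases hall : ∀ j, (cElt a).left (Multiplicative.ofAdd (μ + γ j)) = 1
  · simp only [hall, one_zpow, List.map_const', List.prod_replicate, one_pow]
  push Not at hall
  obtain ⟨i, hi⟩ := hall
  obtain ⟨p, hp⟩ := exists_pow_of_cElt_left_ne_one a hi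
  have key : ∀ j, (cElt a).left (Multiplicative.ofAdd (μ + γ j)) ^ β j =
      (cElt a).left (Multiplicative.ofAdd (μ + γ i)) ^ (if γ j = γ i then β j else 0) := by
    intro j
    split_ifs with h
    · rw [h]
    · have h1 : (cElt a).left (Multiplicative.ofAdd (μ + γ j)) = 1 := by
        by_contra hj
        obtain ⟨q, hq⟩ := exists_pow_of_cElt_left_ne_one a hj
        exact h (eq_of_add_eq_two_pow hμ (abs_le_gamma0 γ j) (abs_le_gamma0 γ i) hq hp)
      rw [h1, one_zpow, zpow_zero]
  simp only [key]
  rw [list_prod_map_const_zpow, ← List.ofFn_eq_map, List.sum_ofFn, ← Finset.sum_filter, hsum i, zpow_zero]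
end

section
/- Let A and B be groups each equipped with a linear order that is both left- and right-invariant under multiplication, and let Γ be a subgroup of A Wr B such that for every element f·b ∈ Γ the support {x ∈ B | f(x) ≠ 1} is a well-ordered subset of B (every nonempty subset of the support has a least element). Then Γ is linearly orderable: there exists a linear order on Γ that is both left- and right-invariant under multiplication. -/
open SemidirectProduct

/-- A function on a linearly ordered domain is lexicographically positive if it has a least
nontrivial argument, at which its value exceeds `1`. -/
def LexPos {A B : Type*} [One A] [LT A] [LT B] (f : B → A) : Prop :=
  ∃ m, (∀ x < m, f x = 1) ∧ 1 < f m

/-- The positive cone of the lexicographic order on a wreath product, in which the active part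
takes precedence. -/
def WrPos {A B : Type*} [Group A] [Group B] [LT A] [LT B] (g : Wr A B) : Prop :=
  1 < g.right ∨ g.right = 1 ∧ LexPos g.left

section Cone

variable {A B : Type*} [Group A] [LinearOrder A] [LinearOrder B]

theorem LexPos.mul [MulLeftMono A] {f g : B → A} (hf : LexPos f) (hg : LexPos g) :
    LexPos (f * g) := by
  obtain ⟨m, hm, hm1⟩ := hf
  obtain ⟨n, hn, hn1⟩ := hg
  rcases lt_trichotomy m n with h | rfl | h
  · exact ⟨m, fun x hx => by simp [hm x hx, hn x (hx.trans h)], by simpa [hn m h] using hm1⟩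
  · exact ⟨m, fun x hx => by simp [hm x hx, hn x hx], by simpa using one_lt_mul' hm1 hn1⟩
  · exact ⟨n, fun x hx => by simp [hn x hx, hm x (hx.trans h)], by simpa [hm n h] using hn1⟩

theorem one_lt_conj [MulLeftMono A] [MulRightMono A] {a : A} (ha : 1 < a) (b : A) :
    1 < b * a * b⁻¹ := by
  simpa using mul_lt_mul_left (mul_lt_mul_right ha b) b⁻¹

theorem LexPos.conj [MulLeftMono A] [MulRightMono A] {f : B → A} (hf : LexPos f) (g : B → A) :
    LexPos (g * f * g⁻¹) := by
  obtain ⟨m, hm, hm1⟩ := hf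
  exact ⟨m, fun x hx => by simp [hm x hx], by simpa using one_lt_conj hm1 (g m)⟩

theorem not_lexPos_one : ¬ LexPos (1 : B → A) := fun ⟨_, _, h⟩ => lt_irrefl _ h

theorem lexPos_or_lexPos_inv [MulLeftMono A] {f : B → A} {m : B} (hm : f m ≠ 1)
    (hmin : ∀ x, f x ≠ 1 → m ≤ x) : LexPos f ∨ LexPos f⁻¹ := by
  have h1 : ∀ x < m, f x = 1 := fun x hx => by_contra fun h => (hmin x h).not_gt hx
  rcases hm.lt_or_gt with h | h
  · exact .inr ⟨m, fun x hx => by simp [h1 x hx], by simpa using h⟩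
  · exact .inl ⟨m, h1, h⟩

variable [Group B]

theorem LexPos.wrAut_apply [MulRightMono B] {f : B → A} (hf : LexPos f) (b : B) :
    LexPos (wrAut A B b f) := by
  obtain ⟨m, hm, hm1⟩ := hf
  refine ⟨m * b⁻¹, fun x hx => hm (x * b) (lt_mul_inv_iff_mul_lt.mp hx), ?_⟩
  change 1 < f (m * b⁻¹ * b)
  simpa using hm1

theorem not_wrPos_one : ¬ WrPos (1 : Wr A B) := by
  simp [WrPos, not_lexPos_one]

theorem WrPos.mul [MulLeftMono A] [MulLeftMono B] {g h : Wr A B}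
    (hg : WrPos g) (hh : WrPos h) : WrPos (g * h) := by
  rcases hg with hg | ⟨hg, hg'⟩ <;> rcases hh with hh | ⟨hh, hh'⟩
  · exact .inl (by simpa using one_lt_mul' hg hh)
  · exact .inl (by simpa [hh] using hg)
  · exact .inl (by simpa [hg] using hh)
  · exact .inr ⟨by simp [hg, hh], by simpa [hg] using hg'.mul hh'⟩

theorem WrPos.conj [MulLeftMono A] [MulRightMono A] [MulLeftMono B] [MulRightMono B]
    {g : Wr A B} (hg : WrPos g) (k : Wr A B) : WrPos (k * g * k⁻¹) := by
  rcases hg with hg | ⟨hg, hg'⟩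
  · exact .inl (by simpa using one_lt_conj hg k.right)
  · refine .inr ⟨by simp [hg], ?_⟩
    have : (k * g * k⁻¹).left = k.left * wrAut A B k.right g.left * k.left⁻¹ := by
      simp [hg]
    rw [this]
    exact (hg'.wrAut_apply k.right).conj k.left

theorem wrPos_or_wrPos_inv [MulLeftMono A] [MulLeftMono B] {g : Wr A B} (hg : g ≠ 1)
    (hsupp : {x | g.left x ≠ 1}.Nonempty → ∃ m, g.left m ≠ 1 ∧ ∀ x, g.left x ≠ 1 → m ≤ x) :
    WrPos g ∨ WrPos g⁻¹ := by
  rcases lt_trichotomy g.right 1 with h | h | h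
  · exact .inr (.inl (by simpa using h))
  · obtain ⟨m, hm, hmin⟩ := hsupp (Function.ne_iff.mp fun h' => hg (SemidirectProduct.ext h' h))
    refine (lexPos_or_lexPos_inv hm hmin).imp (fun h' => .inr ⟨h, h'⟩) fun h' => .inr ⟨?_, ?_⟩
    · simp [h]
    · simpa [h] using h'
  · exact .inl (.inl h)

end Cone

/-- A conjugation-invariant total positive cone yields a bi-invariant linear order. -/
theorem exists_biinvariant_isLinearOrder_of_cone {G : Type*} [Group G] (P : G → Prop)
    (one : ¬ P 1) (mul : ∀ {g h}, P g → P h → P (g * h))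
    (conj : ∀ {g}, P g → ∀ k, P (k * g * k⁻¹)) (total : ∀ {g}, g ≠ 1 → P g ∨ P g⁻¹) :
    ∃ r : G → G → Prop, IsLinearOrder G r ∧
      ∀ g₁ g₂ x : G, r g₁ g₂ → r (g₁ * x) (g₂ * x) ∧ r (x * g₁) (x * g₂) := by
  refine ⟨fun g h => g = h ∨ P (g⁻¹ * h), ?_, ?_⟩
  · refine { refl := fun g => .inl rfl, trans := ?_, antisymm := ?_, total := ?_ }
    · rintro a b c (rfl | hab) (rfl | hbc)
      · exact .inl rfl
      · exact .inr hbc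
      · exact .inr hab
      · exact .inr (by simpa [mul_assoc] using mul hab hbc)
    · rintro a b (h | hab) (h' | hba)
      · exact h
      · exact h
      · exact h'.symm
      · exact (one (by simpa [mul_assoc] using mul hab hba)).elim
    · intro a b
      by_cases h : a = b
      · exact .inl (.inl h)
      · have hne : a⁻¹ * b ≠ 1 := fun h' => h (inv_mul_eq_one.mp h')
        exact (total hne).imp .inr fun h' => .inr (by simpa using h')
  · rintro g h x (rfl | hP)
    · exact ⟨.inl rfl, .inl rfl⟩
    · exact ⟨.inr (by simpa [mul_assoc] using conj hP x⁻¹), .inr (by simpa [mul_assoc] using hP)⟩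

/-- Lemma on orderability of wreath products: if `A` and `B` carry
left- and right-invariant linear orders and `Γ ≤ A Wr B` is such that the support of the
passive part of every element of `Γ` is well-ordered, then `Γ` carries a left- and
right-invariant linear order. -/
theorem stmt13 {A B : Type*} [Group A] [Group B] [LinearOrder A] [LinearOrder B]
    (hAl : ∀ g₁ g₂ x : A, g₁ ≤ g₂ → g₁ * x ≤ g₂ * x)
    (hAr : ∀ g₁ g₂ x : A, g₁ ≤ g₂ → x * g₁ ≤ x * g₂)
    (hBl : ∀ g₁ g₂ x : B, g₁ ≤ g₂ → g₁ * x ≤ g₂ * x)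
    (hBr : ∀ g₁ g₂ x : B, g₁ ≤ g₂ → x * g₁ ≤ x * g₂)
    (Γ : Subgroup (Wr A B))
    (hsupp : ∀ g ∈ Γ, ∀ S ⊆ {x : B | SemidirectProduct.left g x ≠ 1},
      S.Nonempty → ∃ m ∈ S, ∀ x ∈ S, m ≤ x) :
    ∃ r : ↥Γ → ↥Γ → Prop, IsLinearOrder ↥Γ r ∧
      ∀ g₁ g₂ x : ↥Γ, r g₁ g₂ → r (g₁ * x) (g₂ * x) ∧ r (x * g₁) (x * g₂) := by
  have : MulLeftMono A := ⟨fun x _ _ h => hAr _ _ x h⟩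
  have : MulRightMono A := ⟨fun x _ _ h => hAl _ _ x h⟩
  have : MulLeftMono B := ⟨fun x _ _ h => hBr _ _ x h⟩
  have : MulRightMono B := ⟨fun x _ _ h => hBl _ _ x h⟩
  refine exists_biinvariant_isLinearOrder_of_cone (fun g : Γ => WrPos (g : Wr A B))
    not_wrPos_one WrPos.mul (fun hg k => hg.conj (k : Wr A B)) fun {g} hg => ?_
  exact wrPos_or_wrPos_inv (fun h => hg (Subtype.ext h)) (hsupp g g.2 _ subset_rfl)
end

section
/- If H is solvable of derived length l (i.e., the l-th term of the derived series of H is trivial), then G is solvable of derived length at most l + 2 (the (l+2)-nd term of the derived series of G is trivial). -/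
open SemidirectProduct

theorem derivedSeries_pi_eq_bot {ι A : Type*} [Group A] {n : ℕ} (h : derivedSeries A n = ⊥) :
    derivedSeries (ι → A) n = ⊥ := by
  refine (Subgroup.eq_bot_iff_forall _).2 fun f hf => funext fun i => ?_
  have hi := map_derivedSeries_le_derivedSeries (Pi.evalMonoidHom (fun _ : ι => A) i) n
    (Subgroup.mem_map_of_mem _ hf)
  rw [h] at hi
  exact Subgroup.mem_bot.1 hi

theorem derivedSeries_semidirectProduct_succ_le {N B : Type*} [Group N] [CommGroup B]
    (φ : B →* MulAut N) (n : ℕ) :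
    derivedSeries (N ⋊[φ] B) (n + 1) ≤ (derivedSeries N n).map inl := by
  induction n with
  | zero =>
    rw [derivedSeries_zero, ← MonoidHom.range_eq_map, range_inl_eq_ker_rightHom]
    exact Abelianization.commutator_subset_ker rightHom
  | succ n ih =>
    rw [derivedSeries_succ N, Subgroup.map_commutator, derivedSeries_succ]
    exact Subgroup.commutator_mono ih ih

theorem derivedSeries_wr_succ_eq_bot {A B : Type*} [Group A] [CommGroup B] {n : ℕ}
    (h : derivedSeries A n = ⊥) : derivedSeries (Wr A B) (n + 1) = ⊥ := by
  have hle := derivedSeries_semidirectProduct_succ_le (wrAut A B) n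
  rwa [derivedSeries_pi_eq_bot h, Subgroup.map_bot, le_bot_iff] at hle

theorem derivedSeries_subgroup_eq_bot {A : Type*} [Group A] (K : Subgroup A) {n : ℕ}
    (h : derivedSeries A n = ⊥) : derivedSeries K n = ⊥ := by
  have hle := map_derivedSeries_le_derivedSeries K.subtype n
  rwa [h, le_bot_iff, Subgroup.map_eq_bot_iff_of_injective _ K.subtype_injective] at hle

/-- Corollary 2: if `H` is solvable of derived length `l`, then `G` is
solvable of derived length at most `l + 2`. -/
theorem stmt14 {H : Type*} [Group H] (a : ℕ → H)
    (hgen : Subgroup.closure {x : H | ∃ i : ℕ, 1 ≤ i ∧ a i = x} = ⊤)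
    (l : ℕ) (hH : derivedSeries H l = ⊥) :
    derivedSeries ↥(Gsub a) (l + 2) = ⊥ := by
  exact derivedSeries_subgroup_eq_bot _
    (derivedSeries_wr_succ_eq_bot (derivedSeries_wr_succ_eq_bot hH))
end

section
/- If H is locally indicable (for every finitely generated subgroup N ≠ 1 of H there exists a surjective group homomorphism from N onto the infinite cyclic group ℤ), then G is locally indicable. -/
open SemidirectProduct

/-- A group `X` is locally indicable if every nontrivial finitely generated subgroup of `X`
surjects onto the infinite cyclic group `ℤ`. -/
def LocallyIndicable (X : Type*) [Group X] : Prop :=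
  ∀ N : Subgroup X, N.FG → N ≠ ⊥ →
    ∃ f : ↥N →* Multiplicative ℤ, Function.Surjective f

/-- A nontrivial homomorphism from a finitely generated group to a locally indicable group
yields a surjection of its domain onto `ℤ`. -/
theorem LocallyIndicable.exists_surjective_of_ne_one {X Y : Type*} [Group X] [Group Y]
    (hX : LocallyIndicable X) [Group.FG Y] (f : Y →* X) (hf : f ≠ 1) :
    ∃ g : Y →* Multiplicative ℤ, Function.Surjective g := by
  have hfg : f.range.FG := (Group.fg_iff_subgroup_fg _).1 inferInstance
  obtain ⟨g, hg⟩ := hX f.range hfg (by rwa [Ne, MonoidHom.range_eq_bot_iff])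
  exact ⟨g.comp f.rangeRestrict, hg.comp f.rangeRestrict_surjective⟩

/-- Local indicability passes to subgroups. -/
theorem LocallyIndicable.subgroup {X : Type*} [Group X] (hX : LocallyIndicable X)
    (K : Subgroup X) : LocallyIndicable K := by
  intro N hN hne
  have : Group.FG N := (Group.fg_iff_subgroup_fg _).2 hN
  refine hX.exists_surjective_of_ne_one (K.subtype.comp N.subtype) fun h => hne ?_
  refine (Subgroup.eq_bot_iff_forall _).2 fun x hx => ?_
  exact Subtype.ext (DFunLike.congr_fun h (⟨x, hx⟩ : N))

/-- The infinite cyclic group is locally indicable. -/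
theorem locallyIndicable_zm : LocallyIndicable Zm := by
  intro N _ hne
  have : Nontrivial N := (Subgroup.nontrivial_iff_ne_bot N).2 hne
  let e := (intCyclicMulEquiv (G := N)).symm
  exact ⟨e.toMonoidHom, e.surjective⟩

/-- The unrestricted wreath product of locally indicable groups is locally indicable. -/
theorem LocallyIndicable.wr {A B : Type*} [Group A] [Group B] (hA : LocallyIndicable A)
    (hB : LocallyIndicable B) : LocallyIndicable (Wr A B) := by
  intro N hN hne
  have : Group.FG N := (Group.fg_iff_subgroup_fg _).2 hN
  by_cases hr : (rightHom : Wr A B →* B).comp N.subtype = 1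
  · have hright : ∀ n : N, (n : Wr A B).right = 1 := fun n => DFunLike.congr_fun hr n
    let ev (b : B) : N →* A :=
      { toFun := fun n => (n : Wr A B).left b
        map_one' := rfl
        map_mul' := fun n m => by simp [hright n] }
    by_cases hev : ∃ b, ev b ≠ 1
    · obtain ⟨b, hb⟩ := hev
      exact hA.exists_surjective_of_ne_one (ev b) hb
    · push Not at hev
      refine absurd ((Subgroup.eq_bot_iff_forall _).2 fun x hx => ?_) hne
      exact SemidirectProduct.ext (funext fun b => DFunLike.congr_fun (hev b) ⟨x, hx⟩)
        (hright ⟨x, hx⟩)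
  · exact hB.exists_surjective_of_ne_one _ hr

/-- Corollary 3, locally indicable case: if `H` is locally indicable,
then so is `G`. -/
theorem stmt18 {H : Type*} [Group H] (a : ℕ → H)
    (hgen : Subgroup.closure {x : H | ∃ i : ℕ, 1 ≤ i ∧ a i = x} = ⊤)
    (hH : LocallyIndicable H) :
    LocallyIndicable ↥(Gsub a) :=
  ((hH.wr locallyIndicable_zm).wr locallyIndicable_zm).subgroup _
end

section
/- If H is linearly orderable (there exists a linear order on H that is both left- and right-invariant under multiplication), then G is linearly orderable. -/
open SemidirectProduct

/-- `P` is the set of positive elements of a bi-invariant linear order on the subgroup `S`. -/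
structure IsOrderCone {A : Type*} [Group A] (S : Subgroup A) (P : A → Prop) : Prop where
  not_one : ¬ P 1
  mul : ∀ {x y}, x ∈ S → y ∈ S → P x → P y → P (x * y)
  conj : ∀ {g x}, g ∈ S → x ∈ S → P x → P (g * x * g⁻¹)
  eq_one_or : ∀ {x}, x ∈ S → x = 1 ∨ P x ∨ P x⁻¹

theorem IsOrderCone.exists_linearOrder {A : Type*} [Group A] {S G : Subgroup A} {P : A → Prop}
    (h : IsOrderCone S P) (hG : G ≤ S) :
    ∃ r : G → G → Prop, IsLinearOrder G r ∧
      ∀ g₁ g₂ x : G, r g₁ g₂ → r (g₁ * x) (g₂ * x) ∧ r (x * g₁) (x * g₂) := by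
  have hS : ∀ x : G, (x : A) ∈ S := fun x => hG x.2
  have hd : ∀ x y : G, (x : A)⁻¹ * y ∈ S := fun x y => S.mul_mem (S.inv_mem (hS x)) (hS y)
  have htrans : ∀ x y z : G, P ((x : A)⁻¹ * y) → P ((y : A)⁻¹ * z) → P ((x : A)⁻¹ * z) := by
    intro x y z hxy hyz
    have := h.mul (hd x y) (hd y z) hxy hyz
    rwa [mul_assoc, mul_inv_cancel_left] at this
  refine ⟨fun x y => x = y ∨ P ((x : A)⁻¹ * y), ?_, ?_⟩
  · refine { refl := fun x => Or.inl rfl, trans := ?_, antisymm := ?_, total := ?_ }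
    · rintro x y z (rfl | hxy) (rfl | hyz)
      · exact Or.inl rfl
      · exact Or.inr hyz
      · exact Or.inr hxy
      · exact Or.inr (htrans x y z hxy hyz)
    · rintro x y (rfl | hxy) (hyx | hyx)
      · rfl
      · rfl
      · exact hyx.symm
      · have := htrans x y x hxy hyx
        rw [inv_mul_cancel] at this
        exact absurd this h.not_one
    · intro x y
      rcases h.eq_one_or (hd x y) with h1 | h1 | h1
      · exact Or.inl (Or.inl (Subtype.ext (inv_mul_eq_one.mp h1)))
      · exact Or.inl (Or.inr h1)
      · rw [mul_inv_rev, inv_inv] at h1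
        exact Or.inr (Or.inr h1)
  · rintro x y g (rfl | hxy)
    · exact ⟨Or.inl rfl, Or.inl rfl⟩
    · refine ⟨Or.inr ?_, Or.inr ?_⟩
      · have := h.conj (S.inv_mem (hS g)) (hd x y) hxy
        simpa [mul_assoc] using this
      · simpa [mul_assoc] using hxy

theorem isOrderCone_of_isLinearOrder {H : Type*} [Group H] {r : H → H → Prop}
    [IsLinearOrder H r]
    (h : ∀ g₁ g₂ x : H, r g₁ g₂ → r (g₁ * x) (g₂ * x) ∧ r (x * g₁) (x * g₂)) :
    IsOrderCone (⊤ : Subgroup H) (fun x => r 1 x ∧ x ≠ 1) where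
  not_one := fun hx => hx.2 rfl
  mul := by
    rintro x y - - ⟨hx, hx1⟩ ⟨hy, -⟩
    have hxy : r x (x * y) := by simpa using (h 1 y x hy).2
    refine ⟨_root_.trans hx hxy, fun he => hx1 ?_⟩
    rw [he] at hxy
    exact antisymm hxy hx
  conj := by
    rintro g x - - ⟨hx, hx1⟩
    refine ⟨?_, fun he => hx1 (conj_eq_one_iff.mp he)⟩
    have := (h _ _ g⁻¹ (h 1 x g hx).2).1
    simpa using this
  eq_one_or := by
    intro x _
    by_cases hx : x = 1
    · exact Or.inl hx
    rcases total_of r 1 x with h1 | h1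
    · exact Or.inr (Or.inl ⟨h1, hx⟩)
    · refine Or.inr (Or.inr ⟨?_, inv_ne_one.mpr hx⟩)
      simpa using (h x 1 x⁻¹ h1).2

section Wreath

variable {A : Type*} [Group A]

@[simp]
theorem wr_mul_left (x y : Wr A Zm) (k : Zm) :
    (x * y).left k = x.left k * y.left (k * x.right) := rfl

@[simp]
theorem wr_inv_left (x : Wr A Zm) (k : Zm) :
    (x⁻¹).left k = (x.left (k * x.right⁻¹))⁻¹ := rfl

/-- The elements of `A Wr ℤ` whose passive part takes values in `S` and is trivial near `-∞`. -/
def leftBoundedSubgroup (S : Subgroup A) : Subgroup (Wr A Zm) where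
  carrier := {x | (∀ k, x.left k ∈ S) ∧ ∃ N, ∀ k < N, x.left k = 1}
  one_mem' := ⟨fun _ => S.one_mem, 1, fun _ _ => rfl⟩
  mul_mem' := by
    rintro x y ⟨hx, M, hM⟩ ⟨hy, N, hN⟩
    refine ⟨fun k => S.mul_mem (hx _) (hy _), min M (N * x.right⁻¹), fun k hk => ?_⟩
    obtain ⟨h1, h2⟩ := lt_min_iff.mp hk
    rw [wr_mul_left, hM k h1, hN _ (lt_mul_inv_iff_mul_lt.mp h2), one_mul]
  inv_mem' := by
    rintro x ⟨hx, M, hM⟩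
    refine ⟨fun k => S.inv_mem (hx _), M * x.right, fun k hk => ?_⟩
    rw [wr_inv_left, hM _ (mul_inv_lt_iff_lt_mul.mpr hk), inv_one]

/-- Positivity for the order on `A Wr ℤ` that compares active parts first, and then the values of
the passive parts at the least place where they differ. -/
def lexPos (P : A → Prop) (x : Wr A Zm) : Prop :=
  1 < x.right ∨ x.right = 1 ∧ ∃ k, (∀ j < k, x.left j = 1) ∧ P (x.left k)

theorem IsOrderCone.lexPos {S : Subgroup A} {P : A → Prop} (h : IsOrderCone S P) :
    IsOrderCone (leftBoundedSubgroup S) (lexPos P) where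
  not_one := by
    rintro (h1 | ⟨-, k, -, hk⟩)
    · exact lt_irrefl _ h1
    · exact h.not_one hk
  mul := by
    rintro x y ⟨hx, -⟩ ⟨hy, -⟩ (h1 | ⟨h1, k, hk, hkP⟩) (h2 | ⟨h2, l, hl, hlP⟩)
    · exact Or.inl (one_lt_mul'' h1 h2)
    · exact Or.inl (by simpa [h2] using h1)
    · exact Or.inl (by simpa [h1] using h2)
    · refine Or.inr ⟨by simp [h1, h2], min k l, fun j hj => ?_, ?_⟩
      · obtain ⟨h3, h4⟩ := lt_min_iff.mp hj
        simp [h1, hk j h3, hl j h4]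
      · rw [wr_mul_left, h1, mul_one]
        rcases lt_trichotomy k l with hkl | rfl | hkl
        · simpa [min_eq_left hkl.le, hl k hkl] using hkP
        · simpa using h.mul (hx _) (hy _) hkP hlP
        · simpa [min_eq_right hkl.le, hk l hkl] using hlP
  conj := by
    rintro g x ⟨hg, -⟩ ⟨hx, -⟩ (h1 | ⟨h1, k, hk, hkP⟩)
    · exact Or.inl (by simpa [mul_comm g.right] using h1)
    · refine Or.inr ⟨by simp [h1], k * g.right⁻¹, fun j hj => ?_, ?_⟩
      · simp [h1, hk _ (lt_mul_inv_iff_mul_lt.mp hj)]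
      · simpa [h1] using h.conj (hg (k * g.right⁻¹)) (hx k) hkP
  eq_one_or := by
    rintro x ⟨hx, N, hN⟩
    rcases lt_trichotomy x.right 1 with h1 | h1 | h1
    · exact Or.inr (Or.inr (Or.inl (by simpa using h1)))
    · by_cases he : ∃ k, x.left k ≠ 1
      · obtain ⟨k, hk, hmin⟩ := Int.exists_least_of_bdd
          (P := fun n : ℤ => x.left (Multiplicative.ofAdd n) ≠ 1)
          ⟨Multiplicative.toAdd N, fun n hn => not_lt.mp fun hlt => hn (hN _ hlt)⟩ he
        have hlt : ∀ j < Multiplicative.ofAdd k, x.left j = 1 := fun j hj =>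
          not_not.mp fun hne => not_lt.mpr (hmin (Multiplicative.toAdd j) hne) hj
        rcases h.eq_one_or (hx (Multiplicative.ofAdd k)) with h2 | h2 | h2
        · exact absurd h2 hk
        · exact Or.inr (Or.inl (Or.inr ⟨h1, _, hlt, h2⟩))
        · refine Or.inr (Or.inr (Or.inr ⟨by simp [h1], Multiplicative.ofAdd k, ?_, ?_⟩))
          · intro j hj
            simp [h1, hlt j hj]
          · simpa [h1] using h2
      · push Not at he
        exact Or.inl (SemidirectProduct.ext (funext he) h1)
    · exact Or.inr (Or.inl (Or.inl h1))

theorem inr_mem_leftBoundedSubgroup (S : Subgroup A) (n : Zm) :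
    (inr n : Wr A Zm) ∈ leftBoundedSubgroup S :=
  ⟨fun _ => S.one_mem, 1, fun _ _ => rfl⟩

theorem bElt_mem_leftBoundedSubgroup (a : ℕ → A) (i : ℕ) :
    bElt a i ∈ leftBoundedSubgroup (⊤ : Subgroup A) :=
  ⟨fun _ => Subgroup.mem_top _, 1, fun _ hk => if_neg (not_lt.mpr (le_of_lt hk))⟩

theorem Gsub_le_leftBoundedSubgroup (a : ℕ → A) :
    Gsub a ≤ leftBoundedSubgroup (leftBoundedSubgroup ⊤) := by
  refine (Subgroup.closure_le _).mpr ?_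
  rintro x (rfl | rfl)
  · refine ⟨fun k => ?_, Multiplicative.ofAdd 1, fun k hk => ?_⟩
    · simp only [cElt, left_inl]
      split_ifs
      · exact inr_mem_leftBoundedSubgroup _ _
      · exact bElt_mem_leftBoundedSubgroup _ _
      · exact one_mem _
    · replace hk : Multiplicative.toAdd k < 1 := hk
      have h2 : ¬ ∃ i : ℕ, 1 ≤ i ∧ Multiplicative.toAdd k = 2 ^ i := by
        rintro ⟨i, -, hi⟩
        have : (0 : ℤ) < 2 ^ i := by positivity
        omega
      simp only [cElt, left_inl]
      rw [if_neg hk.ne, dif_neg h2]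
  · exact inr_mem_leftBoundedSubgroup _ _

end Wreath

/-- Corollary 4: if `H` admits a left- and right-invariant linear order,
then so does `G`. -/
theorem stmt19 {H : Type*} [Group H] (a : ℕ → H)
    (hgen : Subgroup.closure {x : H | ∃ i : ℕ, 1 ≤ i ∧ a i = x} = ⊤)
    (hH : ∃ r : H → H → Prop, IsLinearOrder H r ∧
      ∀ g₁ g₂ x : H, r g₁ g₂ → r (g₁ * x) (g₂ * x) ∧ r (x * g₁) (x * g₂)) :
    ∃ r : ↥(Gsub a) → ↥(Gsub a) → Prop, IsLinearOrder ↥(Gsub a) r ∧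
      ∀ g₁ g₂ x : ↥(Gsub a), r g₁ g₂ → r (g₁ * x) (g₂ * x) ∧ r (x * g₁) (x * g₂) := by
  obtain ⟨r, hr, hmul⟩ := hH
  exact (isOrderCone_of_isLinearOrder hmul).lexPos.lexPos.exists_linearOrder
    (Gsub_le_leftBoundedSubgroup a)
end
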